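/- arXiv:2109.03725 — 3 statements merged into one kernel-verified Lean document; each statement's English description precedes it below -/
import Mathlib

section
/- Let Z be a compact metrizable space containing at least four points, and let ρ₁, ρ₂ be separating functions on Z. Then ρ₁ and ρ₂ are Moebius equivalent if and only if there exists a (necessarily unique) positive continuous function f : Z → (0,∞) such that ρ₂(ξ,η)² = f(ξ)·f(η)·ρ₁(ξ,η)² for all ξ, η ∈ Z. -/
open Filter Topology
open scoped Classical

variable {Z : Type*}

/-- `Z` has at least four points. -/
def HasFourPoints (Z : Type*) : Prop :=
  ∃ a b c d : Z, a ≠ b ∧ a ≠ c ∧ a ≠ d ∧ b ≠ c ∧ b ≠ d ∧ c ≠ d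

/-- A separating function on `Z`: continuous, symmetric, and positive. -/
structure IsSeparating [TopologicalSpace Z] (ρ : Z → Z → ℝ) : Prop where
  continuous : Continuous fun p : Z × Z => ρ p.1 p.2
  symm : ∀ ξ η, ρ ξ η = ρ η ξ
  nonneg : ∀ ξ η, 0 ≤ ρ ξ η
  eq_zero_iff : ∀ ξ η, ρ ξ η = 0 ↔ ξ = η

/-- The cross-ratio of a quadruple of points with respect to `ρ`. -/
noncomputable def crossRatio (ρ : Z → Z → ℝ) (ξ ξ' η η' : Z) : ℝ :=
  ρ ξ η * ρ ξ' η' / (ρ ξ η' * ρ ξ' η)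

/-- Two functions are Moebius equivalent if their cross-ratios agree on all quadruples
of pairwise distinct points. -/
def MoebiusEquiv (ρ₁ ρ₂ : Z → Z → ℝ) : Prop :=
  ∀ ξ ξ' η η' : Z, ξ ≠ ξ' → ξ ≠ η → ξ ≠ η' → ξ' ≠ η → ξ' ≠ η' → η ≠ η' →
    crossRatio ρ₁ ξ ξ' η η' = crossRatio ρ₂ ξ ξ' η η'

/-- An antipodal function on `Z`: a separating function with values in `[0,1]` such that
every point has an antipode. -/
structure IsAntipodal [TopologicalSpace Z] (ρ : Z → Z → ℝ) : Prop where
  toIsSeparating : IsSeparating ρ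
  le_one : ∀ ξ η, ρ ξ η ≤ 1
  antipode : ∀ ξ, ∃ η, ρ ξ η = 1

/-- The Moebius space `M(Z, ρ₀)`: antipodal functions Moebius equivalent to `ρ₀`. -/
def MoebiusSpace [TopologicalSpace Z] (ρ₀ : Z → Z → ℝ) : Set (Z → Z → ℝ) :=
  {ρ | IsAntipodal ρ ∧ MoebiusEquiv ρ₀ ρ}

/-- The derivative `dρ₂/dρ₁`: the (unique, when it exists) positive continuous function
satisfying the geometric mean value theorem
`ρ₂(ξ,η)² = f(ξ) f(η) ρ₁(ξ,η)²`. -/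
noncomputable def mDeriv [TopologicalSpace Z] (ρ₁ ρ₂ : Z → Z → ℝ) : Z → ℝ :=
  if h : ∃ f : Z → ℝ, Continuous f ∧ (∀ ξ, 0 < f ξ) ∧
      ∀ ξ η, ρ₂ ξ η ^ 2 = f ξ * f η * ρ₁ ξ η ^ 2
  then h.choose else fun _ => 1

/-- The metric `d_M(ρ₁, ρ₂) = ‖log (dρ₂/dρ₁)‖_∞` on the Moebius space. -/
noncomputable def dM [TopologicalSpace Z] (ρ₁ ρ₂ : Z → Z → ℝ) : ℝ :=
  ⨆ ξ : Z, |Real.log (mDeriv ρ₁ ρ₂ ξ)|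

/-- The discrepancy function `D_{ρ₁}(τ)(ξ) = max_{η ≠ ξ} (τ(ξ) + τ(η) + log ρ₁(ξ,η)²)`. -/
noncomputable def discrepancy [TopologicalSpace Z] (ρ₁ : Z → Z → ℝ) (τ : C(Z, ℝ))
    (ξ : Z) : ℝ :=
  ⨆ η : {η : Z // η ≠ ξ}, (τ ξ + τ η.1 + Real.log (ρ₁ ξ η.1 ^ 2))

/-- `E_{ρ₁}(τ)(ξ,η) = e^{τ(ξ)/2} e^{τ(η)/2} ρ₁(ξ,η)`. -/
noncomputable def eMap [TopologicalSpace Z] (ρ₁ : Z → Z → ℝ) (τ : C(Z, ℝ)) :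
    Z → Z → ℝ :=
  fun ξ η => Real.exp (τ ξ / 2) * Real.exp (τ η / 2) * ρ₁ ξ η

/-- A solution of the `ρ₁`-antipodal flow `dτ_t/dt = -D_{ρ₁}(τ_t)` on `[0, ∞)`. -/
def IsAntipodalFlowSol [TopologicalSpace Z] [CompactSpace Z]
    (ρ₁ : Z → Z → ℝ) (τ : ℝ → C(Z, ℝ)) : Prop :=
  ∀ t ∈ Set.Ici (0 : ℝ), ∃ τ' : C(Z, ℝ),
    (∀ ξ, τ' ξ = -discrepancy ρ₁ (τ t) ξ) ∧
    HasDerivWithinAt τ τ' (Set.Ici (0 : ℝ)) t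

/-- The antipodalization map `P_∞(τ₀, ρ₁) = E_{ρ₁}(τ_∞)`, where `τ_∞` is the limit as
`t → ∞` of the solution of the `ρ₁`-antipodal flow starting at `τ₀`. -/
noncomputable def antipodalization [TopologicalSpace Z] [CompactSpace Z]
    (ρ₁ : Z → Z → ℝ) (τ₀ : C(Z, ℝ)) : Z → Z → ℝ :=
  if h : ∃ p : (ℝ → C(Z, ℝ)) × C(Z, ℝ), p.1 0 = τ₀ ∧ IsAntipodalFlowSol ρ₁ p.1 ∧
      Filter.Tendsto p.1 Filter.atTop (𝓝 p.2)
  then eMap ρ₁ h.choose.2 else ρ₁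


lemma IsSeparating.pos [TopologicalSpace Z] {ρ : Z → Z → ℝ} (h : IsSeparating ρ) {x y : Z}
    (hxy : x ≠ y) : 0 < ρ x y :=
  lt_of_le_of_ne (h.nonneg x y) fun e => hxy ((h.eq_zero_iff x y).1 e.symm)

lemma HasFourPoints.exists_ne_ne (h : HasFourPoints Z) (x : Z) :
    ∃ y z : Z, x ≠ y ∧ x ≠ z ∧ y ≠ z := by
  obtain ⟨a, b, c, d, hab, hac, had, hbc, hbd, hcd⟩ := h
  by_cases hxa : x = a
  · exact ⟨b, c, by rwa [hxa], by rwa [hxa], hbc⟩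
  · by_cases hxb : x = b
    · exact ⟨a, c, hxa, by rwa [hxb], hac⟩
    · exact ⟨a, b, hxa, hxb, hab⟩

/-- The metric derivative at `x` of `ρ₂` with respect to `ρ₁`, computed through the auxiliary
points `y` and `z`. -/
noncomputable def tripleRatio (ρ₁ ρ₂ : Z → Z → ℝ) (x y z : Z) : ℝ :=
  ρ₂ x y / ρ₁ x y * (ρ₂ x z / ρ₁ x z) / (ρ₂ y z / ρ₁ y z)

section TripleRatio

variable [TopologicalSpace Z] {ρ₁ ρ₂ : Z → Z → ℝ}

lemma tripleRatio_pos (h₁ : IsSeparating ρ₁) (h₂ : IsSeparating ρ₂) {x y z : Z}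
    (hxy : x ≠ y) (hxz : x ≠ z) (hyz : y ≠ z) : 0 < tripleRatio ρ₁ ρ₂ x y z := by
  have := h₁.pos hxy
  have := h₁.pos hxz
  have := h₁.pos hyz
  have := h₂.pos hxy
  have := h₂.pos hxz
  have := h₂.pos hyz
  unfold tripleRatio
  positivity

lemma tripleRatio_swap (h₁ : IsSeparating ρ₁) (h₂ : IsSeparating ρ₂) (x y z : Z) :
    tripleRatio ρ₁ ρ₂ x y z = tripleRatio ρ₁ ρ₂ x z y := by
  unfold tripleRatio
  rw [h₁.symm y z, h₂.symm y z, mul_comm]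

lemma tripleRatio_mul_tripleRatio (h₁ : IsSeparating ρ₁) (h₂ : IsSeparating ρ₂) {x y z : Z}
    (hxy : x ≠ y) (hxz : x ≠ z) (hyz : y ≠ z) :
    tripleRatio ρ₁ ρ₂ x y z * tripleRatio ρ₁ ρ₂ y x z * ρ₁ x y ^ 2 = ρ₂ x y ^ 2 := by
  have := (h₁.pos hxy).ne'
  have := (h₁.pos hxz).ne'
  have := (h₁.pos hyz).ne'
  have := (h₂.pos hxz).ne'
  have := (h₂.pos hyz).ne'
  unfold tripleRatio
  rw [h₁.symm y x, h₂.symm y x]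
  field_simp

lemma MoebiusEquiv.tripleRatio_congr_right (hM : MoebiusEquiv ρ₁ ρ₂)
    (h₁ : IsSeparating ρ₁) (h₂ : IsSeparating ρ₂) {x y z w : Z}
    (hxy : x ≠ y) (hxz : x ≠ z) (hxw : x ≠ w) (hyz : y ≠ z) (hyw : y ≠ w) :
    tripleRatio ρ₁ ρ₂ x y z = tripleRatio ρ₁ ρ₂ x y w := by
  by_cases hzw : z = w
  · rw [hzw]
  have key := hM x y z w hxy hxz hxw hyz hyw hzw
  have := (h₁.pos hxy).ne'
  have := (h₁.pos hxz).ne'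
  have := (h₁.pos hxw).ne'
  have := (h₁.pos hyz).ne'
  have := (h₁.pos hyw).ne'
  have := (h₂.pos hxz).ne'
  have := (h₂.pos hxw).ne'
  have := (h₂.pos hyz).ne'
  have := (h₂.pos hyw).ne'
  unfold crossRatio at key
  unfold tripleRatio
  field_simp at key ⊢
  linear_combination -ρ₂ x y * key

lemma MoebiusEquiv.tripleRatio_congr (hM : MoebiusEquiv ρ₁ ρ₂)
    (h₁ : IsSeparating ρ₁) (h₂ : IsSeparating ρ₂) {x y z y' z' : Z}
    (hxy : x ≠ y) (hxz : x ≠ z) (hyz : y ≠ z)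
    (hxy' : x ≠ y') (hxz' : x ≠ z') (hyz' : y' ≠ z') :
    tripleRatio ρ₁ ρ₂ x y z = tripleRatio ρ₁ ρ₂ x y' z' := by
  rw [tripleRatio_swap h₁ h₂ x y' z']
  by_cases h : y = z'
  · subst h
    exact hM.tripleRatio_congr_right h₁ h₂ hxy hxz hxy' hyz hyz'.symm
  · rw [hM.tripleRatio_congr_right h₁ h₂ hxy hxz hxz' hyz h, tripleRatio_swap h₁ h₂ x y z']
    exact hM.tripleRatio_congr_right h₁ h₂ hxz' hxy hxy' (Ne.symm h) hyz'.symm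

lemma continuousAt_tripleRatio (h₁ : IsSeparating ρ₁) (h₂ : IsSeparating ρ₂) {x y z : Z}
    (hxy : x ≠ y) (hxz : x ≠ z) :
    ContinuousAt (fun w => tripleRatio ρ₁ ρ₂ w y z) x := by
  have c : ∀ {ρ : Z → Z → ℝ}, IsSeparating ρ → ∀ a, ContinuousAt (fun w => ρ w a) x :=
    fun h a => (h.continuous.comp (by fun_prop : Continuous fun w : Z => (w, a))).continuousAt
  unfold tripleRatio
  exact (((c h₂ y).div (c h₁ y) (h₁.pos hxy).ne').mul
    ((c h₂ z).div (c h₁ z) (h₁.pos hxz).ne')).div_const _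

lemma MoebiusEquiv.exists_derivative [T1Space Z] (hM : MoebiusEquiv ρ₁ ρ₂) (h4 : HasFourPoints Z)
    (h₁ : IsSeparating ρ₁) (h₂ : IsSeparating ρ₂) :
    ∃ f : Z → ℝ, Continuous f ∧ (∀ ξ, 0 < f ξ) ∧
      ∀ ξ η, ρ₂ ξ η ^ 2 = f ξ * f η * ρ₁ ξ η ^ 2 := by
  choose u v hu hv huv using h4.exists_ne_ne
  have hf : ∀ {x y z : Z}, x ≠ y → x ≠ z → y ≠ z →
      tripleRatio ρ₁ ρ₂ x (u x) (v x) = tripleRatio ρ₁ ρ₂ x y z := fun hxy hxz hyz =>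
    hM.tripleRatio_congr h₁ h₂ (hu _) (hv _) (huv _) hxy hxz hyz
  refine ⟨fun x => tripleRatio ρ₁ ρ₂ x (u x) (v x), ?_,
    fun x => tripleRatio_pos h₁ h₂ (hu x) (hv x) (huv x), fun x y => ?_⟩
  · refine continuous_iff_continuousAt.2 fun x => ?_
    refine (continuousAt_tripleRatio h₁ h₂ (hu x) (hv x)).congr ?_
    filter_upwards [isOpen_ne.mem_nhds (hu x), isOpen_ne.mem_nhds (hv x)] with w hwu hwv
    exact (hf hwu hwv (huv x)).symm
  · by_cases hxy : x = y
    · subst hxy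
      simp [(h₁.eq_zero_iff x x).2 rfl, (h₂.eq_zero_iff x x).2 rfl]
    · obtain ⟨z, hxz, hyz⟩ : ∃ z, x ≠ z ∧ y ≠ z := by
        by_cases h : y = u x
        · exact ⟨v x, hv x, h ▸ huv x⟩
        · exact ⟨u x, hu x, h⟩
      simp only [hf hxy hxz hyz, hf (Ne.symm hxy) hyz hxz]
      exact (tripleRatio_mul_tripleRatio h₁ h₂ hxy hxz hyz).symm

lemma derivative_sq_eq (h₁ : IsSeparating ρ₁) {f : Z → ℝ} (hpos : ∀ ξ, 0 < f ξ)
    (hf : ∀ ξ η, ρ₂ ξ η ^ 2 = f ξ * f η * ρ₁ ξ η ^ 2) {x y z : Z}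
    (hxy : x ≠ y) (hxz : x ≠ z) (hyz : y ≠ z) :
    f x ^ 2 = tripleRatio ρ₁ ρ₂ x y z ^ 2 := by
  have := (h₁.pos hxy).ne'
  have := (h₁.pos hxz).ne'
  have := (h₁.pos hyz).ne'
  have := (hpos y).ne'
  have := (hpos z).ne'
  simp only [tripleRatio, div_pow, mul_pow, hf]
  field_simp

lemma derivative_unique (h4 : HasFourPoints Z) (h₁ : IsSeparating ρ₁) {f g : Z → ℝ}
    (hfpos : ∀ ξ, 0 < f ξ) (hf : ∀ ξ η, ρ₂ ξ η ^ 2 = f ξ * f η * ρ₁ ξ η ^ 2)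
    (hgpos : ∀ ξ, 0 < g ξ) (hg : ∀ ξ η, ρ₂ ξ η ^ 2 = g ξ * g η * ρ₁ ξ η ^ 2) : f = g := by
  funext x
  obtain ⟨y, z, hxy, hxz, hyz⟩ := h4.exists_ne_ne x
  refine (pow_left_inj₀ (hfpos x).le (hgpos x).le two_ne_zero).1 ?_
  rw [derivative_sq_eq h₁ hfpos hf hxy hxz hyz, derivative_sq_eq h₁ hgpos hg hxy hxz hyz]

lemma IsSeparating.crossRatio_nonneg {ρ : Z → Z → ℝ} (h : IsSeparating ρ) (ξ ξ' η η' : Z) :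
    0 ≤ crossRatio ρ ξ ξ' η η' :=
  div_nonneg (mul_nonneg (h.nonneg _ _) (h.nonneg _ _))
    (mul_nonneg (h.nonneg _ _) (h.nonneg _ _))

lemma moebiusEquiv_of_derivative (h₁ : IsSeparating ρ₁) (h₂ : IsSeparating ρ₂) {f : Z → ℝ}
    (hpos : ∀ ξ, 0 < f ξ) (hf : ∀ ξ η, ρ₂ ξ η ^ 2 = f ξ * f η * ρ₁ ξ η ^ 2) :
    MoebiusEquiv ρ₁ ρ₂ := by
  intro x x' y y' _ _ hxy' hx'y _ _
  refine (pow_left_inj₀ (h₁.crossRatio_nonneg x x' y y') (h₂.crossRatio_nonneg x x' y y')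
    two_ne_zero).1 ?_
  have := (h₁.pos hxy').ne'
  have := (h₁.pos hx'y).ne'
  have := (hpos x).ne'
  have := (hpos x').ne'
  have := (hpos y).ne'
  have := (hpos y').ne'
  simp only [crossRatio, div_pow, mul_pow, hf]
  field_simp

end TripleRatio

theorem statement0 [TopologicalSpace Z] [CompactSpace Z]
    [TopologicalSpace.MetrizableSpace Z] (h4 : HasFourPoints Z)
    (ρ₁ ρ₂ : Z → Z → ℝ) (h₁ : IsSeparating ρ₁) (h₂ : IsSeparating ρ₂) :
    MoebiusEquiv ρ₁ ρ₂ ↔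
      ∃! f : Z → ℝ, Continuous f ∧ (∀ ξ, 0 < f ξ) ∧
        ∀ ξ η, ρ₂ ξ η ^ 2 = f ξ * f η * ρ₁ ξ η ^ 2 := by
  constructor
  · intro hM
    obtain ⟨f, hc, hpos, hf⟩ := hM.exists_derivative h4 h₁ h₂
    exact ⟨f, ⟨hc, hpos, hf⟩, fun g hg => derivative_unique h4 h₁ hg.2.1 hg.2.2 hpos hf⟩
  · rintro ⟨f, ⟨-, hpos, hf⟩, -⟩
    exact moebiusEquiv_of_derivative h₁ h₂ hpos hf
end

section
/- Let (Z,ρ₀) be an antipodal space, ρ₁ ∈ M(Z), and let t ↦ τ_t, t ∈ [0,∞), be a solution of the ρ₁-antipodal flow. Then for every ξ ∈ Z and t ≥ 0 the right-hand derivative (d⁺/dt) D_{ρ₁}(τ_t)(ξ) exists and satisfies (d⁺/dt) D_{ρ₁}(τ_t)(ξ) ≤ −2 D_{ρ₁}(τ_t)(ξ); consequently D_{ρ₁}(τ_t)(ξ) ≤ D_{ρ₁}(τ_s)(ξ)·e^{−2(t−s)} for all t ≥ s ≥ 0. -/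
open Filter Topology
open scoped Classical

variable {Z : Type*}

/-- The quantity whose maximum over `η ≠ ξ` is the discrepancy of `τ` at `ξ`. -/
noncomputable def discrepancyTerm [TopologicalSpace Z] (ρ : Z → Z → ℝ) (τ : C(Z, ℝ))
    (ξ η : Z) : ℝ :=
  τ ξ + τ η + Real.log (ρ ξ η ^ 2)

section Discrepancy

variable [TopologicalSpace Z] {ρ : Z → Z → ℝ}

theorem IsAntipodal.exists_ne (hρ : IsAntipodal ρ) (ξ : Z) : ∃ η, η ≠ ξ := by
  obtain ⟨η, hη⟩ := hρ.antipode ξ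
  refine ⟨η, fun h => ?_⟩
  rw [(hρ.toIsSeparating.eq_zero_iff ξ η).2 h.symm] at hη
  exact zero_ne_one hη

theorem IsSeparating.pos_s5 (hρ : IsSeparating ρ) {ξ η : Z} (h : η ≠ ξ) : 0 < ρ ξ η :=
  lt_of_le_of_ne (hρ.nonneg ξ η) fun h' => h ((hρ.eq_zero_iff ξ η).1 h'.symm).symm

theorem exp_discrepancyTerm (hρ : IsSeparating ρ) (τ : C(Z, ℝ)) {ξ η : Z} (h : η ≠ ξ) :
    Real.exp (discrepancyTerm ρ τ ξ η) = Real.exp (τ ξ + τ η) * ρ ξ η ^ 2 := by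
  rw [discrepancyTerm, Real.exp_add, Real.exp_log (pow_pos (hρ.pos_s5 h) 2)]

theorem continuous_exp_mul_sq (hρ : IsSeparating ρ) (τ : C(Z, ℝ)) (ξ : Z) :
    Continuous fun η => Real.exp (τ ξ + τ η) * ρ ξ η ^ 2 := by
  have h : Continuous fun η => ρ ξ η :=
    hρ.continuous.comp (Continuous.prodMk_right ξ)
  fun_prop

/-- On a compact set containing a point other than `ξ`, the discrepancy term is maximal at some
point other than `ξ`, although it is singular at `ξ`. -/
theorem exists_isMaxOn_discrepancyTerm (hρ : IsSeparating ρ) (τ : C(Z, ℝ)) (ξ : Z)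
    {K : Set Z} (hK : IsCompact K) (hne : ∃ η ∈ K, η ≠ ξ) :
    ∃ η ∈ K, η ≠ ξ ∧ ∀ ζ ∈ K, ζ ≠ ξ → discrepancyTerm ρ τ ξ ζ ≤ discrepancyTerm ρ τ ξ η := by
  obtain ⟨ζ₀, hζ₀, hζ₀ξ⟩ := hne
  obtain ⟨η, hη, hmax⟩ :=
    hK.exists_isMaxOn ⟨ζ₀, hζ₀⟩ (continuous_exp_mul_sq hρ τ ξ).continuousOn
  have hηξ : η ≠ ξ := by
    rintro rfl
    have h1 := hmax hζ₀
    simp only [Set.mem_ofPred_eq, (hρ.eq_zero_iff η η).2 rfl] at h1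
    have h2 := pow_pos (hρ.pos_s5 hζ₀ξ) 2
    have h3 := mul_pos (Real.exp_pos (τ η + τ ζ₀)) h2
    norm_num at h1
    linarith
  refine ⟨η, hη, hηξ, fun ζ hζ hζξ => ?_⟩
  rw [← Real.exp_le_exp, exp_discrepancyTerm hρ τ hζξ, exp_discrepancyTerm hρ τ hηξ]
  exact hmax hζ

variable [CompactSpace Z]

theorem discrepancy_isMax (hρ : IsAntipodal ρ) (τ : C(Z, ℝ)) (ξ : Z) :
    (∃ η, η ≠ ξ ∧ discrepancyTerm ρ τ ξ η = discrepancy ρ τ ξ) ∧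
      ∀ η, η ≠ ξ → discrepancyTerm ρ τ ξ η ≤ discrepancy ρ τ ξ := by
  obtain ⟨ζ₀, hζ₀⟩ := hρ.exists_ne ξ
  obtain ⟨η, -, hηξ, hmax⟩ := exists_isMaxOn_discrepancyTerm hρ.toIsSeparating τ ξ
    isCompact_univ ⟨ζ₀, Set.mem_univ _, hζ₀⟩
  have h : IsGreatest (Set.range fun ζ : {ζ : Z // ζ ≠ ξ} => discrepancyTerm ρ τ ξ ζ.1)
      (discrepancyTerm ρ τ ξ η) :=
    ⟨⟨⟨η, hηξ⟩, rfl⟩, by rintro _ ⟨ζ, rfl⟩; exact hmax ζ.1 (Set.mem_univ _) ζ.2⟩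
  have hD : discrepancy ρ τ ξ = discrepancyTerm ρ τ ξ η := h.csSup_eq
  exact ⟨⟨η, hηξ, hD.symm⟩, fun ζ hζ => hD ▸ hmax ζ (Set.mem_univ _) hζ⟩

theorem exists_discrepancyTerm_eq (hρ : IsAntipodal ρ) (τ : C(Z, ℝ)) (ξ : Z) :
    ∃ η, η ≠ ξ ∧ discrepancyTerm ρ τ ξ η = discrepancy ρ τ ξ :=
  (discrepancy_isMax hρ τ ξ).1

theorem discrepancyTerm_le (hρ : IsAntipodal ρ) (τ : C(Z, ℝ)) {ξ η : Z} (h : η ≠ ξ) :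
    discrepancyTerm ρ τ ξ η ≤ discrepancy ρ τ ξ :=
  (discrepancy_isMax hρ τ ξ).2 η h

/-- If `η` realizes the discrepancy at `ξ`, then the discrepancy at `η` is at least that
at `ξ`. -/
theorem discrepancy_le_of_discrepancyTerm_eq (hρ : IsAntipodal ρ) (τ : C(Z, ℝ)) {ξ η : Z}
    (h : η ≠ ξ) (hη : discrepancyTerm ρ τ ξ η = discrepancy ρ τ ξ) :
    discrepancy ρ τ ξ ≤ discrepancy ρ τ η := by
  have h1 := discrepancyTerm_le hρ τ h.symm
  rw [← hη]
  rw [discrepancyTerm, hρ.toIsSeparating.symm η ξ] at h1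
  rw [discrepancyTerm]
  linarith

/-- Away from a neighbourhood of the maximizers, the discrepancy term is bounded away from its
maximum. -/
theorem exists_pos_discrepancyTerm_le_sub (hρ : IsAntipodal ρ) (τ : C(Z, ℝ)) (ξ : Z)
    {U : Set Z} (hU : IsOpen U)
    (hmem : ∀ η, η ≠ ξ → discrepancyTerm ρ τ ξ η = discrepancy ρ τ ξ → η ∈ U) :
    ∃ δ > 0, ∀ η ∉ U, η ≠ ξ → discrepancyTerm ρ τ ξ η ≤ discrepancy ρ τ ξ - δ := by
  by_cases hne : ∃ η ∈ Uᶜ, η ≠ ξ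
  · obtain ⟨η, hη, hηξ, hmax⟩ := exists_isMaxOn_discrepancyTerm hρ.toIsSeparating τ ξ
      hU.isClosed_compl.isCompact hne
    have hlt : discrepancyTerm ρ τ ξ η < discrepancy ρ τ ξ :=
      lt_of_le_of_ne (discrepancyTerm_le hρ τ hηξ) fun h => hη (hmem η hηξ h)
    refine ⟨discrepancy ρ τ ξ - discrepancyTerm ρ τ ξ η, sub_pos.2 hlt, fun ζ hζ hζξ => ?_⟩
    have := hmax ζ hζ hζξ
    linarith
  · push Not at hne
    exact ⟨1, one_pos, fun η hη hηξ => (hηξ (hne η hη)).elim⟩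

/-- A continuous function attains a maximum on the set of maximizers of the discrepancy term. -/
theorem exists_max_on_discrepancyTerm_eq (hρ : IsAntipodal ρ) (τ g : C(Z, ℝ)) (ξ : Z) :
    ∃ η, (η ≠ ξ ∧ discrepancyTerm ρ τ ξ η = discrepancy ρ τ ξ) ∧
      ∀ ζ, ζ ≠ ξ → discrepancyTerm ρ τ ξ ζ = discrepancy ρ τ ξ → g ζ ≤ g η := by
  have hM : {η | η ≠ ξ ∧ discrepancyTerm ρ τ ξ η = discrepancy ρ τ ξ} =
      {η | Real.exp (τ ξ + τ η) * ρ ξ η ^ 2 = Real.exp (discrepancy ρ τ ξ)} := by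
    ext η
    by_cases h : η = ξ
    · subst h
      simp [(hρ.toIsSeparating.eq_zero_iff η η).2 rfl, (Real.exp_ne_zero _).symm]
    · simp [h, ← exp_discrepancyTerm hρ.toIsSeparating τ h]
  have hc : IsCompact {η | η ≠ ξ ∧ discrepancyTerm ρ τ ξ η = discrepancy ρ τ ξ} := by
    rw [hM]
    exact (isClosed_eq (continuous_exp_mul_sq hρ.toIsSeparating τ ξ)
      continuous_const).isCompact
  obtain ⟨η, hη, hmax⟩ := hc.exists_isMaxOn (exists_discrepancyTerm_eq hρ τ ξ)
    g.continuous.continuousOn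
  exact ⟨η, hη, fun ζ h1 h2 => hmax ⟨h1, h2⟩⟩

theorem discrepancy_le_add (hρ : IsAntipodal ρ) (τ σ : C(Z, ℝ)) (ξ : Z) :
    discrepancy ρ τ ξ ≤ discrepancy ρ σ ξ + 2 * ‖τ - σ‖ := by
  obtain ⟨η, hη, hηD⟩ := exists_discrepancyTerm_eq hρ τ ξ
  have h1 := discrepancyTerm_le hρ σ hη
  have h2 := (le_abs_self _).trans ((τ - σ).norm_coe_le_norm ξ)
  have h3 := (le_abs_self _).trans ((τ - σ).norm_coe_le_norm η)
  simp only [ContinuousMap.sub_apply] at h2 h3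
  rw [← hηD]
  simp only [discrepancyTerm] at h1 ⊢
  linarith

theorem continuous_discrepancy (hρ : IsAntipodal ρ) (ξ : Z) :
    Continuous fun τ : C(Z, ℝ) => discrepancy ρ τ ξ := by
  refine (LipschitzWith.of_le_add_mul 2 fun τ σ => ?_).continuous
  rw [dist_eq_norm]
  exact_mod_cast discrepancy_le_add hρ τ σ ξ

/-- The right derivative of the discrepancy along a curve is the maximum of the derivatives of
the terms realizing it. -/
theorem hasDerivWithinAt_discrepancy (hρ : IsAntipodal ρ) {τ : ℝ → C(Z, ℝ)} {τ' : C(Z, ℝ)}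
    {t : ℝ} (hτ : HasDerivWithinAt τ τ' (Set.Ici t) t) {ξ η : Z} (hηξ : η ≠ ξ)
    (hη : discrepancyTerm ρ (τ t) ξ η = discrepancy ρ (τ t) ξ)
    (hmax : ∀ ζ, ζ ≠ ξ → discrepancyTerm ρ (τ t) ξ ζ = discrepancy ρ (τ t) ξ → τ' ζ ≤ τ' η) :
    HasDerivWithinAt (fun s => discrepancy ρ (τ s) ξ) (τ' ξ + τ' η) (Set.Ici t) t := by
  rw [hasDerivWithinAt_iff_isLittleO, Asymptotics.isLittleO_iff] at hτ ⊢
  intro c hc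
  obtain ⟨δ, hδ, hgap⟩ := exists_pos_discrepancyTerm_le_sub hρ (τ t) ξ
    (U := {ζ | τ' ζ < τ' η + c / 2}) (isOpen_lt τ'.continuous continuous_const)
    (fun ζ h1 h2 => by
      have := hmax ζ h1 h2
      simp only [Set.mem_ofPred_eq]
      linarith)
  have hsmall : ∀ᶠ s in 𝓝[Set.Ici t] t, (s - t) * (2 * ‖τ'‖ + c) < δ := by
    refine Filter.Tendsto.eventually_lt_const hδ (tendsto_nhdsWithin_of_tendsto_nhds ?_)
    have : Continuous fun s : ℝ => (s - t) * (2 * ‖τ'‖ + c) := by fun_prop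
    simpa using this.tendsto t
  filter_upwards [hτ (show 0 < c / 4 by positivity), hsmall, self_mem_nhdsWithin]
    with s hs hsδ hst
  have hst : 0 ≤ s - t := sub_nonneg.2 hst
  have key : ∀ ζ, |τ s ζ - τ t ζ - (s - t) * τ' ζ| ≤ c / 4 * (s - t) := fun ζ => by
    have := ((τ s - τ t - (s - t) • τ').norm_coe_le_norm ζ).trans hs
    simpa [abs_of_nonneg hst] using this
  have hξ := abs_le.1 (key ξ)
  rw [Real.norm_eq_abs, Real.norm_eq_abs, abs_of_nonneg hst, smul_eq_mul, abs_le]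
  constructor
  · have h1 := discrepancyTerm_le hρ (τ s) hηξ
    have h2 := abs_le.1 (key η)
    rw [← hη]
    simp only [discrepancyTerm] at h1 ⊢
    nlinarith [mul_nonneg hc.le hst]
  · obtain ⟨ζ, hζξ, hζ⟩ := exists_discrepancyTerm_eq hρ (τ s) ξ
    have h2 := abs_le.1 (key ζ)
    rw [← hζ]
    by_cases hU : τ' ζ < τ' η + c / 2
    · have h1 := discrepancyTerm_le hρ (τ t) hζξ
      have h3 := mul_le_mul_of_nonneg_left hU.le hst
      simp only [discrepancyTerm] at h1 ⊢
      linarith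
    · have h1 := hgap ζ hU hζξ
      have h4 := (abs_le.1 (τ'.norm_coe_le_norm ζ)).2
      have h5 := (abs_le.1 (τ'.norm_coe_le_norm η)).1
      have h3 := mul_le_mul_of_nonneg_left
        (show τ' ζ - τ' η ≤ 2 * ‖τ'‖ by linarith) hst
      simp only [discrepancyTerm] at h1 ⊢
      nlinarith [mul_nonneg hc.le hst]

end Discrepancy

/-- Gronwall's inequality for a function whose right derivative is at most a multiple of it. -/
theorem le_mul_exp_of_hasDerivWithinAt_le {u u' : ℝ → ℝ} {k a b : ℝ} (hab : a ≤ b)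
    (hu : ContinuousOn u (Set.Icc a b))
    (hu' : ∀ x ∈ Set.Ico a b, HasDerivWithinAt u (u' x) (Set.Ici x) x)
    (hle : ∀ x ∈ Set.Ico a b, u' x ≤ k * u x) :
    u b ≤ u a * Real.exp (k * (b - a)) := by
  have hexp : ∀ x, HasDerivAt (fun x => Real.exp (-k * (x - a)))
      (Real.exp (-k * (x - a)) * -k) x := fun x => by
    simpa using (((hasDerivAt_id x).sub_const a).const_mul (-k)).exp
  have h := image_le_of_deriv_right_le_deriv_boundary
    (f := fun x => u x * Real.exp (-k * (x - a))) (B := fun _ => u a) (B' := fun _ => 0)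
    (hu.mul (by fun_prop))
    (fun x hx => (hu' x hx).mul (hexp x).hasDerivWithinAt) (by simp) continuousOn_const
    (fun x _ => hasDerivWithinAt_const _ _ _)
    (fun x hx => by nlinarith [hle x hx, Real.exp_pos (-k * (x - a))])
    (Set.right_mem_Icc.2 hab)
  have hmul := mul_le_mul_of_nonneg_right h (Real.exp_pos (k * (b - a))).le
  rwa [mul_assoc, ← Real.exp_add, neg_mul, neg_add_cancel, Real.exp_zero, mul_one] at hmul

theorem statement5 [TopologicalSpace Z] [CompactSpace Z]
    [TopologicalSpace.MetrizableSpace Z] (h4 : HasFourPoints Z)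
    (ρ₀ : Z → Z → ℝ) (h₀ : IsAntipodal ρ₀)
    (ρ₁ : Z → Z → ℝ) (hρ₁ : ρ₁ ∈ MoebiusSpace ρ₀)
    (τ : ℝ → C(Z, ℝ)) (hτ : IsAntipodalFlowSol ρ₁ τ) :
    (∀ (ξ : Z) (t : ℝ), 0 ≤ t →
      ∃ L : ℝ, HasDerivWithinAt (fun s => discrepancy ρ₁ (τ s) ξ) L (Set.Ici t) t ∧
        L ≤ -2 * discrepancy ρ₁ (τ t) ξ) ∧
    (∀ (ξ : Z) (s t : ℝ), 0 ≤ s → s ≤ t →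
      discrepancy ρ₁ (τ t) ξ ≤ discrepancy ρ₁ (τ s) ξ * Real.exp (-2 * (t - s))) := by
  have hρ : IsAntipodal ρ₁ := hρ₁.1
  have hderiv : ∀ (ξ : Z) (t : ℝ), 0 ≤ t →
      ∃ L : ℝ, HasDerivWithinAt (fun s => discrepancy ρ₁ (τ s) ξ) L (Set.Ici t) t ∧
        L ≤ -2 * discrepancy ρ₁ (τ t) ξ := by
    intro ξ t ht
    obtain ⟨τ', hτ', hd⟩ := hτ t ht
    obtain ⟨η, ⟨hηξ, hη⟩, hmax⟩ := exists_max_on_discrepancyTerm_eq hρ (τ t) τ' ξ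
    refine ⟨τ' ξ + τ' η, hasDerivWithinAt_discrepancy hρ
      (hd.mono (Set.Ici_subset_Ici.2 ht)) hηξ hη hmax, ?_⟩
    have := discrepancy_le_of_discrepancyTerm_eq hρ (τ t) hηξ hη
    rw [hτ', hτ']
    linarith
  refine ⟨hderiv, fun ξ s t hs hst => ?_⟩
  have hcont : ContinuousOn τ (Set.Ici 0) := fun r hr =>
    (hτ r hr).choose_spec.2.continuousWithinAt
  choose! u' hu' hle using hderiv ξ
  exact le_mul_exp_of_hasDerivWithinAt_le hst
    ((continuous_discrepancy hρ ξ).comp_continuousOn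
      (hcont.mono fun r hr => hs.trans hr.1))
    (fun r hr => hu' r (hs.trans hr.1)) (fun r hr => hle r (hs.trans hr.1))
end

section
/- Let (Z,ρ₀) be an antipodal space, ρ₁ ∈ M(Z), and let t ↦ τ_t, t ∈ [0,∞), be a solution of the ρ₁-antipodal flow. Then ‖D_{ρ₁}(τ_t)‖_∞ ≤ 2‖D_{ρ₁}(τ_0)‖_∞ · e^{−t/2} for all t ≥ 0. -/
open Filter Topology
open scoped Classical

variable {Z : Type*}

open Set

section Discrepancy

variable [TopologicalSpace Z] {ρ : Z → Z → ℝ}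

theorem discrepancy_le (hρ : IsAntipodal ρ) (σ : C(Z, ℝ)) (ξ : Z) {c : ℝ}
    (h : ∀ η, η ≠ ξ → σ ξ + σ η + Real.log (ρ ξ η ^ 2) ≤ c) : discrepancy ρ σ ξ ≤ c := by
  obtain ⟨η, hη⟩ := hρ.antipode ξ
  have hne : η ≠ ξ := by
    rintro rfl
    rw [(hρ.toIsSeparating.eq_zero_iff η η).2 rfl] at hη
    exact zero_ne_one hη
  have : Nonempty {η : Z // η ≠ ξ} := ⟨⟨η, hne⟩⟩
  exact ciSup_le fun η => h η.1 η.2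

variable [CompactSpace Z]

theorem discrepancy_bddAbove (hρ : IsAntipodal ρ) (σ : C(Z, ℝ)) (ξ : Z) :
    BddAbove (range fun η : {η : Z // η ≠ ξ} => σ ξ + σ η.1 + Real.log (ρ ξ η.1 ^ 2)) := by
  refine ⟨‖σ‖ + ‖σ‖, ?_⟩
  rintro _ ⟨η, rfl⟩
  have h1 := (abs_le.1 (σ.norm_coe_le_norm ξ)).2
  have h2 := (abs_le.1 (σ.norm_coe_le_norm η.1)).2
  have h3 : Real.log (ρ ξ η.1 ^ 2) ≤ 0 :=
    Real.log_nonpos (sq_nonneg _)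
      (pow_le_one₀ (hρ.toIsSeparating.nonneg _ _) (hρ.le_one _ _))
  dsimp only
  linarith

theorem le_discrepancy (hρ : IsAntipodal ρ) (σ : C(Z, ℝ)) {ξ η : Z} (h : η ≠ ξ) :
    σ ξ + σ η + Real.log (ρ ξ η ^ 2) ≤ discrepancy ρ σ ξ :=
  le_ciSup (discrepancy_bddAbove hρ σ ξ) ⟨η, h⟩

theorem le_discrepancy_right (hρ : IsAntipodal ρ) (σ : C(Z, ℝ)) {ξ η : Z} (h : η ≠ ξ) :
    σ ξ + σ η + Real.log (ρ ξ η ^ 2) ≤ discrepancy ρ σ η := by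
  have := le_discrepancy hρ σ h.symm
  rw [hρ.toIsSeparating.symm η ξ] at this
  linarith

variable {τ : ℝ → C(Z, ℝ)}

theorem IsAntipodalFlowSol.hasDerivWithinAt_apply (hτ : IsAntipodalFlowSol ρ τ) {t : ℝ}
    (ht : 0 ≤ t) (ξ : Z) :
    HasDerivWithinAt (fun s => τ s ξ) (-discrepancy ρ (τ t) ξ) (Ici 0) t := by
  obtain ⟨τ', h, hd⟩ := hτ t ht
  rw [← h ξ]
  exact (ContinuousMap.evalCLM ℝ ξ).hasFDerivAt.comp_hasDerivWithinAt t hd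

theorem IsAntipodalFlowSol.abs_discrepancy_le_iSup (hτ : IsAntipodalFlowSol ρ τ) {t : ℝ}
    (ht : 0 ≤ t) (ξ : Z) :
    |discrepancy ρ (τ t) ξ| ≤ ⨆ η : Z, |discrepancy ρ (τ t) η| := by
  obtain ⟨τ', h, -⟩ := hτ t ht
  refine le_ciSup (f := fun η : Z => |discrepancy ρ (τ t) η|) ⟨‖τ'‖, ?_⟩ ξ
  rintro _ ⟨η, rfl⟩
  have := τ'.norm_coe_le_norm η
  rwa [h, norm_neg] at this

/-- A function with nonnegative one-sided derivative on a convex subset of `[0, ∞)` is monotone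
there. -/
theorem monotoneOn_of_hasDerivWithinAt_Ici {s : Set ℝ} (hs : Convex ℝ s) (hs0 : s ⊆ Ici 0)
    {f f' : ℝ → ℝ} (hf : ∀ x ∈ s, HasDerivWithinAt f (f' x) (Ici 0) x)
    (hf' : ∀ x ∈ s, 0 ≤ f' x) : MonotoneOn f s :=
  monotoneOn_of_hasDerivWithinAt_nonneg hs
    (fun x hx => ((hf x hx).mono hs0).continuousWithinAt)
    (fun x hx => (hf x (interior_subset hx)).mono (interior_subset.trans hs0))
    (fun x hx => hf' x (interior_subset hx))

theorem hasDerivAt_exp_const_mul (c t : ℝ) :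
    HasDerivAt (fun s => Real.exp (c * s)) (c * Real.exp (c * t)) t := by
  simpa [mul_comm] using ((hasDerivAt_id t).const_mul c).exp

/-- The positive part of the discrepancy decays at rate `e^{-2t}` along the flow. -/
theorem IsAntipodalFlowSol.discrepancy_le_mul_exp (hρ : IsAntipodal ρ)
    (hτ : IsAntipodalFlowSol ρ τ) {M : ℝ} (hM : ∀ ξ, discrepancy ρ (τ 0) ξ ≤ M) {t : ℝ}
    (ht : 0 ≤ t) (ξ : Z) : discrepancy ρ (τ t) ξ ≤ M * Real.exp (-2 * t) := by
  refine discrepancy_le hρ _ _ fun η hη => ?_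
  have hmono := monotoneOn_of_hasDerivWithinAt_Ici (convex_Ici (0 : ℝ)) Subset.rfl
    (fun x hx => ((hasDerivAt_exp_const_mul 2 x).hasDerivWithinAt.mul
      (((hτ.hasDerivWithinAt_apply hx ξ).add (hτ.hasDerivWithinAt_apply hx η)).add_const
        (Real.log (ρ ξ η ^ 2)))).neg) (fun x hx => by
      have h1 := le_discrepancy hρ (τ x) hη
      have h2 := le_discrepancy_right hρ (τ x) hη
      have h3 := Real.exp_pos (2 * x)
      simp only [Pi.add_apply]
      nlinarith)
  have h := hmono self_mem_Ici ht ht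
  simp only [Pi.neg_apply, Pi.mul_apply, Pi.add_apply, mul_zero, Real.exp_zero, one_mul,
    neg_le_neg_iff] at h
  have h0 := (le_discrepancy hρ (τ 0) hη).trans (hM ξ)
  rw [neg_mul, Real.exp_neg, ← div_eq_mul_inv, le_div_iff₀ (Real.exp_pos _)]
  linarith

/-- Up to a decaying correction, `D(τ_t)(ξ) - τ_t(ξ)` increases along the flow. -/
theorem IsAntipodalFlowSol.monotoneOn_discrepancy_sub (hρ : IsAntipodal ρ)
    (hτ : IsAntipodalFlowSol ρ τ) {M : ℝ} (hM : ∀ ξ, discrepancy ρ (τ 0) ξ ≤ M) (ξ : Z) :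
    MonotoneOn (fun t => discrepancy ρ (τ t) ξ - τ t ξ - M / 2 * Real.exp (-2 * t))
      (Ici 0) := by
  intro s hs t ht hst
  suffices discrepancy ρ (τ s) ξ ≤ discrepancy ρ (τ t) ξ - τ t ξ - M / 2 * Real.exp (-2 * t)
      + τ s ξ + M / 2 * Real.exp (-2 * s) by
    dsimp only
    linarith
  refine discrepancy_le hρ _ _ fun η hη => ?_
  have hmono := monotoneOn_of_hasDerivWithinAt_Ici (convex_Ici (0 : ℝ)) Subset.rfl
    (fun x hx => (hτ.hasDerivWithinAt_apply hx η).sub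
      ((hasDerivAt_exp_const_mul (-2) x).const_mul (M / 2)).hasDerivWithinAt) (fun x hx => by
      have h1 := hτ.discrepancy_le_mul_exp hρ hM hx η
      linarith)
  have h := hmono hs ht hst
  simp only [Pi.sub_apply] at h
  have h1 := le_discrepancy hρ (τ t) hη
  linarith

/-- The negative part of the discrepancy decays at rate `e^{-t}` along the flow. -/
theorem IsAntipodalFlowSol.neg_mul_exp_le_discrepancy (hρ : IsAntipodal ρ)
    (hτ : IsAntipodalFlowSol ρ τ) {M : ℝ} (hM : ∀ ξ, |discrepancy ρ (τ 0) ξ| ≤ M) {t : ℝ}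
    (ht : 0 ≤ t) (ξ : Z) : -(2 * M * Real.exp (-t)) ≤ discrepancy ρ (τ t) ξ := by
  have hM0 : 0 ≤ M := (abs_nonneg _).trans (hM ξ)
  have hmono := hτ.monotoneOn_discrepancy_sub hρ (fun ξ => (abs_le.1 (hM ξ)).2) ξ
  set H := discrepancy ρ (τ t) ξ - τ t ξ - M / 2 * Real.exp (-2 * t) with hH
  have hexp (x : ℝ) : Real.exp x * Real.exp (-2 * x) = Real.exp (-x) := by
    rw [← Real.exp_add]
    ring_nf
  have hmono' := monotoneOn_of_hasDerivWithinAt_Ici (convex_Icc (0 : ℝ) t)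
    Icc_subset_Ici_self
    (fun x hx => ((Real.hasDerivAt_exp x).hasDerivWithinAt.mul
      ((hτ.hasDerivWithinAt_apply hx.1 ξ).add_const H)).sub
      ((hasDerivAt_exp_const_mul (-1) x).const_mul (M / 2)).hasDerivWithinAt) (fun x hx => by
      have h1 := mul_le_mul_of_nonneg_left (hmono hx.1 ht hx.2) (Real.exp_pos x).le
      have h2 := hexp x
      simp only [← hH] at h1
      rw [neg_one_mul x]
      linear_combination h1 + M / 2 * h2)
  have h := hmono' (left_mem_Icc.2 ht) (right_mem_Icc.2 ht) ht
  have h0 := hmono self_mem_Ici ht ht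
  simp only [Pi.sub_apply, Pi.mul_apply, mul_zero, neg_one_mul, neg_zero, Real.exp_zero,
    mul_one, ← hH] at h h0
  have hD0 := (abs_le.1 (hM ξ)).1
  have hpos := mul_nonneg hM0 (Real.exp_pos (-t)).le
  have key : -(2 * M) ≤ Real.exp t * discrepancy ρ (τ t) ξ := by
    have hD : Real.exp t * discrepancy ρ (τ t) ξ
        = Real.exp t * (τ t ξ + H) + M / 2 * Real.exp (-t) := by
      rw [← hexp t, hH]
      ring
    linarith
  rw [Real.exp_neg, ← div_eq_mul_inv, ← neg_div, div_le_iff₀ (Real.exp_pos _)]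
  linarith

end Discrepancy

theorem statement6 [TopologicalSpace Z] [CompactSpace Z]
    [TopologicalSpace.MetrizableSpace Z] (h4 : HasFourPoints Z)
    (ρ₀ : Z → Z → ℝ) (h₀ : IsAntipodal ρ₀)
    (ρ₁ : Z → Z → ℝ) (hρ₁ : ρ₁ ∈ MoebiusSpace ρ₀)
    (τ : ℝ → C(Z, ℝ)) (hτ : IsAntipodalFlowSol ρ₁ τ) :
    ∀ t : ℝ, 0 ≤ t → ∀ ξ : Z,
      |discrepancy ρ₁ (τ t) ξ| ≤
        2 * (⨆ η : Z, |discrepancy ρ₁ (τ 0) η|) * Real.exp (-t / 2) := by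
  intro t ht ξ
  have hM := hτ.abs_discrepancy_le_iSup le_rfl
  set M := ⨆ η : Z, |discrepancy ρ₁ (τ 0) η|
  have hM0 : 0 ≤ M := (abs_nonneg _).trans (hM ξ)
  have hlow := hτ.neg_mul_exp_le_discrepancy hρ₁.1 hM ht ξ
  have hupp := hτ.discrepancy_le_mul_exp hρ₁.1 (fun ξ => (abs_le.1 (hM ξ)).2) ht ξ
  have h1 : Real.exp (-t) ≤ Real.exp (-t / 2) := Real.exp_le_exp.2 (by linarith)
  have h2 : Real.exp (-2 * t) ≤ Real.exp (-t / 2) := Real.exp_le_exp.2 (by linarith)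
  have h3 := mul_nonneg hM0 (Real.exp_pos (-t / 2)).le
  have h4 := mul_le_mul_of_nonneg_left h1 hM0
  have h5 := mul_le_mul_of_nonneg_left h2 hM0
  exact abs_le.2 ⟨by linarith, by linarith⟩
end
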